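/- Let R be a commutative Noetherian ring of finite Krull dimension and let C_* be a chain complex of R-modules concentrated in non-positive degrees (C_n = 0 for n > 0) such that each C_n is a flat R-module and each H_n(C_*) is a flat R-module. Then for every R-module M and every integer n, the natural map H_n(C_*) ⊗_R M → H_n(C_* ⊗_R M) is an isomorphism. In particular, taking M = R/pR for a prime number p, one has H_n(C_*) ⊗_R R/pR ≅ H_n(C_* ⊗_R R/pR) for all n. -/

import Mathlib

open TensorProduct

section ChainComplexDefs

variable {R : Type} [CommRing R] {C : ℤ → Type}
  [∀ n, AddCommGroup (C n)] [∀ n, Module R (C n)]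

/-- Transport a module along an equality of indices. -/
def lcast {m n : ℤ} (h : m = n) : C m →ₗ[R] C n := by subst h; exact LinearMap.id

variable (d : ∀ n : ℤ, C n →ₗ[R] C (n - 1))

/-- The `n`-cycles of the chain complex `(C, d)`. -/
def cyclesAt (n : ℤ) : Submodule R (C n) := LinearMap.ker (d n)

/-- The `n`-boundaries of the chain complex `(C, d)`. -/
def boundariesAt (n : ℤ) : Submodule R (C n) :=
  LinearMap.range ((lcast (show n + 1 - 1 = n by ring)).comp (d (n + 1)))

/-- The `n`-th homology of the chain complex `(C, d)`: the quotient of the cycles by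
the boundaries. -/
abbrev homologyAt (n : ℤ) : Type :=
  cyclesAt d n ⧸ (boundariesAt d n).comap (cyclesAt d n).subtype

/-- `φ` is the natural comparison map `H_n(C) ⊗ M → H_n(C ⊗ M)`: it sends the class of a
cycle `z` tensored with `m` to the class of the cycle `z ⊗ m` of the tensored complex. -/
def IsHomologyTensorComparison (M : Type) [AddCommGroup M] [Module R M] (n : ℤ)
    (φ : (homologyAt d n) ⊗[R] M →ₗ[R]
      homologyAt (C := fun k => C k ⊗[R] M) (fun k => (d k).rTensor M) n) : Prop :=
  ∀ (z : cyclesAt d n) (m : M)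
    (h : (z : C n) ⊗ₜ[R] m ∈ cyclesAt (C := fun k => C k ⊗[R] M) (fun k => (d k).rTensor M) n),
    φ ((Submodule.Quotient.mk z) ⊗ₜ[R] m) = Submodule.Quotient.mk ⟨(z : C n) ⊗ₜ[R] m, h⟩

end ChainComplexDefs

section Purity

universe u

variable {R : Type u} [CommRing R] {A B Q M M' M'' : Type u}
  [AddCommGroup A] [Module R A] [AddCommGroup B] [Module R B] [AddCommGroup Q] [Module R Q]
  [AddCommGroup M] [Module R M] [AddCommGroup M'] [Module R M'] [AddCommGroup M''] [Module R M'']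

theorem LinearMap.lTensor_rTensor_comm (i : A →ₗ[R] B) (f : M →ₗ[R] M') (z : A ⊗[R] M) :
    f.lTensor B (i.rTensor M z) = i.rTensor M' (f.lTensor A z) := by
  rw [← LinearMap.comp_apply, ← LinearMap.comp_apply, LinearMap.lTensor_comp_rTensor,
    LinearMap.rTensor_comp_lTensor]

theorem LinearMap.rTensor_injective_of_lTensor_injective {i : A →ₗ[R] B} {f : M' →ₗ[R] M}
    (hf : Function.Injective (f.lTensor A)) (hM : Function.Injective (i.rTensor M)) :
    Function.Injective (i.rTensor M') := by
  rw [injective_iff_map_eq_zero] at hf hM ⊢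
  refine fun z hz ↦ hf z (hM _ ?_)
  rw [← LinearMap.lTensor_rTensor_comm, hz, map_zero]

theorem LinearMap.rTensor_injective_of_exact [Module.Flat R B] {i : A →ₗ[R] B}
    {f : M' →ₗ[R] M} {g : M →ₗ[R] M''} (hf : Function.Injective f) (hg : Function.Surjective g)
    (hfg : Function.Exact f g) (hM' : Function.Injective (i.rTensor M'))
    (hM'' : Function.Injective (i.rTensor M'')) : Function.Injective (i.rTensor M) := by
  rw [injective_iff_map_eq_zero] at hM' hM'' ⊢
  intro z hz
  have h : g.lTensor A z = 0 := hM'' _ (by rw [← LinearMap.lTensor_rTensor_comm, hz, map_zero])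
  obtain ⟨w, rfl⟩ := (lTensor_exact A hfg hg z).1 h
  rw [hM' w, map_zero]
  apply (injective_iff_map_eq_zero _).1
    (Module.Flat.lTensor_preserves_injective_linearMap (M := B) f hf)
  rw [LinearMap.lTensor_rTensor_comm, hz]

theorem LinearMap.rTensor_injective_of_finite [Module.Flat R B] {i : A →ₗ[R] B}
    (h : ∀ N : Submodule R M, Module.Finite R N → Function.Injective (i.rTensor N)) :
    Function.Injective (i.rTensor M) := by
  rw [injective_iff_map_eq_zero]
  intro z hz
  obtain ⟨N, hN, hzN⟩ :=
    TensorProduct.exists_finite_submodule_right_of_setFinite {z} (Set.finite_singleton z)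
  obtain ⟨w, rfl⟩ := hzN rfl
  rw [(injective_iff_map_eq_zero _).1 (h N hN) w, map_zero]
  apply (injective_iff_map_eq_zero _).1 (Module.Flat.lTensor_preserves_injective_linearMap (M := B)
    N.subtype N.injective_subtype)
  rw [LinearMap.lTensor_rTensor_comm, hz]

theorem LinearMap.rTensor_injective_of_quotient [Module.Flat R Q] {i : A →ₗ[R] B} {e : B →ₗ[R] Q}
    {f : M' →ₗ[R] M} {g : M →ₗ[R] M''} (hf : Function.Injective f) (hg : Function.Surjective g)
    (hfg : Function.Exact f g) (hie : ∀ z, e (i z) = 0)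
    (hM' : Function.Exact (i.rTensor M') (e.rTensor M'))
    (hM : Function.Injective (i.rTensor M)) : Function.Injective (i.rTensor M'') := by
  rw [injective_iff_map_eq_zero]
  intro z hz
  obtain ⟨y, rfl⟩ := LinearMap.lTensor_surjective A hg z
  rw [← LinearMap.lTensor_rTensor_comm] at hz
  obtain ⟨b, hb⟩ := (lTensor_exact B hfg hg _).1 hz
  have hzero : e.rTensor M (i.rTensor M y) = 0 := by
    rw [← LinearMap.rTensor_comp_apply, show e ∘ₗ i = 0 from LinearMap.ext hie,
      LinearMap.rTensor_zero, LinearMap.zero_apply]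
  have hb0 : e.rTensor M' b = 0 := by
    apply (injective_iff_map_eq_zero _).1
      (Module.Flat.lTensor_preserves_injective_linearMap (M := Q) f hf)
    rw [LinearMap.lTensor_rTensor_comm, hb, hzero]
  obtain ⟨a, rfl⟩ := (hM' b).1 hb0
  rw [LinearMap.lTensor_rTensor_comm] at hb
  rw [← hM hb, ← LinearMap.comp_apply, ← LinearMap.lTensor_comp, hfg.linearMap_comp_eq_zero,
    LinearMap.lTensor_zero, LinearMap.zero_apply]

theorem Module.Flat.of_rTensor_injective [Module.Flat R B] {i : A →ₗ[R] B} {q : B →ₗ[R] Q}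
    (hq : Function.Surjective q) (hiq : Function.Exact i q)
    (h : ∀ (M : Type u) [AddCommGroup M] [Module R M], Function.Injective (i.rTensor M)) :
    Module.Flat R Q := by
  rw [Module.Flat.iff_lTensor_preserves_injective_linearMap'.{u}]
  intro M' M _ _ _ _ f hf
  rw [injective_iff_map_eq_zero]
  intro x hx
  obtain ⟨b, rfl⟩ := LinearMap.rTensor_surjective M' hq x
  rw [LinearMap.lTensor_rTensor_comm] at hx
  obtain ⟨a, ha⟩ := (_root_.rTensor_exact M hiq hq _).1 hx
  have hfg := LinearMap.exact_map_mkQ_range f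
  have ha0 : (LinearMap.range f).mkQ.lTensor A a = 0 := by
    apply (injective_iff_map_eq_zero _).1 (h _)
    rw [← LinearMap.lTensor_rTensor_comm, ha]
    exact (_root_.lTensor_exact B hfg (Submodule.mkQ_surjective _) _).2 ⟨b, rfl⟩
  obtain ⟨a', rfl⟩ := (_root_.lTensor_exact A hfg (Submodule.mkQ_surjective _) _).1 ha0
  rw [← LinearMap.lTensor_rTensor_comm] at ha
  rw [← Module.Flat.lTensor_preserves_injective_linearMap (M := B) f hf ha]
  exact (_root_.rTensor_exact M' hiq hq _).2 ⟨a', rfl⟩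

theorem Module.Flat.rTensor_injective_of_exact [Module.Flat R Q] {i : A →ₗ[R] B} {q : B →ₗ[R] Q}
    (hi : Function.Injective i) (hq : Function.Surjective q) (hiq : Function.Exact i q)
    (M : Type u) [AddCommGroup M] [Module R M] : Function.Injective (i.rTensor M) := by
  obtain ⟨F, _, _, _, g, hg⟩ : ∃ (F : Type u) (_ : AddCommGroup F) (_ : Module R F)
      (_ : Module.Flat R F) (g : F →ₗ[R] M), Function.Surjective g :=
    ⟨M →₀ R, inferInstance, inferInstance, inferInstance, Finsupp.linearCombination R id,
      Finsupp.linearCombination_id_surjective R M⟩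
  exact LinearMap.rTensor_injective_of_quotient (LinearMap.ker g).injective_subtype hg
    (LinearMap.exact_subtype_ker_map g) hiq.apply_apply_eq_zero (_root_.rTensor_exact _ hiq hq)
    (Module.Flat.rTensor_preserves_injective_linearMap i hi)

theorem Module.Flat.of_exact [Module.Flat R A] [Module.Flat R Q] {i : A →ₗ[R] B} {q : B →ₗ[R] Q}
    (hi : Function.Injective i) (hq : Function.Surjective q) (hiq : Function.Exact i q) :
    Module.Flat R B := by
  rw [Module.Flat.iff_lTensor_preserves_injective_linearMap'.{u}]
  intro M' M _ _ _ _ f hf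
  rw [injective_iff_map_eq_zero]
  intro b hb
  have hqb : q.rTensor M' b = 0 := by
    apply (injective_iff_map_eq_zero _).1
      (Module.Flat.lTensor_preserves_injective_linearMap (M := Q) f hf)
    rw [LinearMap.lTensor_rTensor_comm, hb, map_zero]
  obtain ⟨a, rfl⟩ := (_root_.rTensor_exact M' hiq hq b).1 hqb
  rw [LinearMap.lTensor_rTensor_comm] at hb
  have := (injective_iff_map_eq_zero _).1
    (Module.Flat.rTensor_injective_of_exact hi hq hiq M) _ hb
  rw [(injective_iff_map_eq_zero _).1
    (Module.Flat.lTensor_preserves_injective_linearMap (M := A) f hf) a this, map_zero]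

end Purity

section DepthReduction

universe u

/-- Over a Noetherian local ring, a predicate on quotients by proper ideals which is stable under
cutting by a nonzerodivisor and holds for the ring itself holds for some quotient containing a copy
of the residue field. -/
theorem IsLocalRing.exists_residueField_injective {S : Type u} [CommRing S] [IsNoetherianRing S]
    [IsLocalRing S] (P : Ideal S → Prop) (hbot : P ⊥)
    (hcut : ∀ (J : Ideal S) (x : S), J ≠ ⊤ → IsSMulRegular (S ⧸ J) x → P J →
      P (Ideal.span {x} ⊔ J)) :
    ∃ J : Ideal S, P J ∧
      ∃ f : (S ⧸ IsLocalRing.maximalIdeal S) →ₗ[S] (S ⧸ J), Function.Injective f := by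
  obtain ⟨J, ⟨hJ, hPJ⟩, hmax⟩ := set_has_maximal_iff_noetherian.2 ‹IsNoetherianRing S›
    {J : Ideal S | J ≠ ⊤ ∧ P J} ⟨⊥, bot_ne_top, hbot⟩
  refine ⟨J, hPJ, ?_⟩
  have hsub : (IsLocalRing.maximalIdeal S : Set S) ⊆ ⋃ p ∈ associatedPrimes S (S ⧸ J), p := by
    rw [biUnion_associatedPrimes_eq_compl_regular]
    intro x hx hreg
    refine hmax _ ⟨fun htop ↦ ?_, hcut J x hJ hreg hPJ⟩ ?_
    · have : Ideal.span {x} ⊔ J ≤ IsLocalRing.maximalIdeal S :=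
        sup_le ((Ideal.span_singleton_le_iff_mem _).2 hx) (IsLocalRing.le_maximalIdeal hJ)
      exact Ideal.IsPrime.ne_top' (top_le_iff.1 (htop ▸ this))
    · refine lt_of_le_of_ne le_sup_right fun heq ↦ ?_
      have hxJ : x ∈ J := heq ▸ Ideal.mem_sup_left (Ideal.mem_span_singleton_self x)
      have h1 : (1 : S ⧸ J) = 0 := hreg (by
        change x • (1 : S ⧸ J) = x • (0 : S ⧸ J)
        rw [smul_zero, Algebra.smul_def, mul_one]
        exact Ideal.Quotient.eq_zero_iff_mem.2 hxJ)
      exact hJ ((Ideal.eq_top_iff_one _).2 (Ideal.Quotient.eq_zero_iff_mem.1 h1))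
  obtain ⟨p, hp, hle⟩ := ((IsLocalRing.maximalIdeal S).subset_union_prime_finite
    (associatedPrimes.finite S (S ⧸ J)) (f := id) 0 0 fun _ h _ _ ↦ h.isPrime).1 hsub
  have hpm : p = IsLocalRing.maximalIdeal S :=
    le_antisymm (IsLocalRing.le_maximalIdeal hp.isPrime.ne_top) hle
  subst hpm
  exact ((isAssociatedPrime_iff_exists_injective_linearMap _ _).1 hp).2

end DepthReduction

section FlatComplex

variable {R : Type} [CommRing R] {C : ℤ → Type}
  [∀ n, AddCommGroup (C n)] [∀ n, Module R (C n)] (d : ∀ n : ℤ, C n →ₗ[R] C (n - 1))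

theorem boundariesAt_eq_range {k m : ℤ} (hk : k = m + 1) (hm : k - 1 = m) :
    boundariesAt d m = LinearMap.range ((lcast (R := R) (C := C) hm).comp (d k)) := by
  subst hk; rfl

theorem boundariesAt_sub_one (n : ℤ) : boundariesAt d (n - 1) = LinearMap.range (d n) :=
  boundariesAt_eq_range d (by ring) rfl

theorem exists_rTensor_boundariesAt (n : ℤ) (M : Type) [AddCommGroup M] [Module R M]
    {x : C n ⊗[R] M}
    (hx : x ∈ boundariesAt (C := fun k => C k ⊗[R] M) (fun k => (d k).rTensor M) n) :
    ∃ b : boundariesAt d n ⊗[R] M, (boundariesAt d n).subtype.rTensor M b = x := by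
  obtain ⟨m, rfl⟩ : ∃ m, n = m - 1 := ⟨n + 1, by ring⟩
  rw [boundariesAt_sub_one] at hx ⊢
  obtain ⟨y, rfl⟩ := hx
  refine ⟨(d m).rangeRestrict.rTensor M y, ?_⟩
  rw [← LinearMap.rTensor_comp_apply, LinearMap.subtype_comp_codRestrict]

variable {d}

theorem boundariesAt_le_cyclesAt (hd : ∀ n : ℤ, (d (n - 1)).comp (d n) = 0) (n : ℤ) :
    boundariesAt d n ≤ cyclesAt d n := by
  obtain ⟨m, rfl⟩ : ∃ m, n = m - 1 := ⟨n + 1, by ring⟩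
  rw [boundariesAt_sub_one]
  rintro _ ⟨y, rfl⟩
  exact LinearMap.congr_fun (hd m) y

theorem exact_inclusion_mkQ (hd : ∀ n : ℤ, (d (n - 1)).comp (d n) = 0) (n : ℤ) :
    Function.Exact (Submodule.inclusion (boundariesAt_le_cyclesAt hd n))
      ((boundariesAt d n).comap (cyclesAt d n).subtype).mkQ := by
  rw [LinearMap.exact_iff, Submodule.ker_mkQ, Submodule.range_inclusion]

variable (d) in
/-- Tensoring with `M` preserves injectivity of the inclusion of the `n`-cycles. -/
def CyclesTensorInjective (n : ℤ) (M : Type) [AddCommGroup M] [Module R M] : Prop :=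
  Function.Injective ((cyclesAt d n).subtype.rTensor M)

variable {n : ℤ} {M : Type} [AddCommGroup M] [Module R M]

theorem rTensor_boundariesAt_injective
    (hd : ∀ n : ℤ, (d (n - 1)).comp (d n) = 0)
    (hHflat : ∀ n : ℤ, Module.Flat R (homologyAt d n))
    (hM : CyclesTensorInjective d n M) :
    Function.Injective ((boundariesAt d n).subtype.rTensor M) := by
  have := hHflat n
  rw [← Submodule.subtype_comp_inclusion _ _ (boundariesAt_le_cyclesAt hd n),
    LinearMap.rTensor_comp]
  exact hM.comp (Module.Flat.rTensor_injective_of_exact (Submodule.inclusion_injective _)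
    (Submodule.mkQ_surjective _) (exact_inclusion_mkQ hd n) M)

theorem exact_rTensor_cyclesAt
    (hd : ∀ n : ℤ, (d (n - 1)).comp (d n) = 0)
    (hHflat : ∀ n : ℤ, Module.Flat R (homologyAt d n))
    (hM : CyclesTensorInjective d (n - 1) M) :
    Function.Exact ((cyclesAt d n).subtype.rTensor M) ((d n).rTensor M) := by
  have hinj := rTensor_boundariesAt_injective hd hHflat hM
  rw [boundariesAt_sub_one] at hinj
  have hexact : Function.Exact (cyclesAt d n).subtype (d n).rangeRestrict := by
    rw [LinearMap.exact_iff, LinearMap.ker_rangeRestrict, Submodule.range_subtype, cyclesAt]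
  have := (rTensor_exact M hexact (d n).surjective_rangeRestrict).comp_injective _ hinj
    (map_zero _)
  rwa [← LinearMap.coe_comp, ← LinearMap.rTensor_comp,
    LinearMap.subtype_comp_codRestrict] at this

theorem cyclesTensorInjective_quotient_sup_span
    (hd : ∀ n : ℤ, (d (n - 1)).comp (d n) = 0)
    (hHflat : ∀ n : ℤ, Module.Flat R (homologyAt d n))
    (hCflat : ∀ n : ℤ, Module.Flat R (C n))
    {S : Type} [CommRing S] [Algebra R S] (J : Ideal S) (x : S) (hx : IsSMulRegular (S ⧸ J) x)
    (hJ : ∀ n, CyclesTensorInjective d n (S ⧸ J)) (n : ℤ) :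
    CyclesTensorInjective d n (S ⧸ (Ideal.span {x} ⊔ J)) := by
  have := hCflat (n - 1)
  have := hCflat n
  let f : (S ⧸ J) →ₗ[R] (S ⧸ J) := LinearMap.mulLeft R (Ideal.Quotient.mk J x)
  let g : (S ⧸ J) →ₗ[R] (S ⧸ (Ideal.span {x} ⊔ J)) :=
    (Ideal.Quotient.factorₐ R le_sup_right).toLinearMap
  have hf : Function.Injective f := fun a b hab ↦ hx (by
    simpa [f, Algebra.smul_def] using hab)
  have hg : Function.Surjective g := Ideal.Quotient.factor_surjective le_sup_right
  have hfg : Function.Exact f g := by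
    intro y
    obtain ⟨y, rfl⟩ := Ideal.Quotient.mk_surjective y
    change Ideal.Quotient.mk _ y = 0 ↔ _
    rw [Ideal.Quotient.eq_zero_iff_mem, Ideal.mem_span_singleton_sup]
    constructor
    · rintro ⟨a, b, hb, rfl⟩
      refine ⟨Ideal.Quotient.mk J a, ?_⟩
      simp [f, Ideal.Quotient.eq_zero_iff_mem.2 hb, mul_comm]
    · rintro ⟨a, ha⟩
      obtain ⟨a, rfl⟩ := Ideal.Quotient.mk_surjective a
      refine ⟨a, y - a * x, ?_, by ring⟩
      rw [← Ideal.Quotient.eq_zero_iff_mem, map_sub, ← ha]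
      simp [f, mul_comm]
  exact LinearMap.rTensor_injective_of_quotient hf hg hfg (fun z ↦ z.2)
    (exact_rTensor_cyclesAt hd hHflat (hJ (n - 1))) (hJ n)

theorem cyclesTensorInjective_quotient_prime [IsNoetherianRing R]
    (hd : ∀ n : ℤ, (d (n - 1)).comp (d n) = 0)
    (hHflat : ∀ n : ℤ, Module.Flat R (homologyAt d n))
    (hCflat : ∀ n : ℤ, Module.Flat R (C n)) (hZ : Module.Flat R (cyclesAt d n))
    (p : Ideal R) [p.IsPrime] : CyclesTensorInjective d n (R ⧸ p) := by
  have hS : IsNoetherianRing (Localization.AtPrime p) :=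
    IsLocalization.isNoetherianRing p.primeCompl _ inferInstance
  obtain ⟨J, hJ, f, hf⟩ := IsLocalRing.exists_residueField_injective
    (S := Localization.AtPrime p) (fun J ↦ ∀ n, CyclesTensorInjective d n (_ ⧸ J))
    (fun n ↦ by
      have : Module.Flat R (Localization.AtPrime p ⧸ (⊥ : Ideal (Localization.AtPrime p))) :=
        Module.Flat.of_linearEquiv
          (AlgEquiv.quotientBot R (Localization.AtPrime p)).toLinearEquiv
      exact Module.Flat.rTensor_preserves_injective_linearMap _ (Submodule.injective_subtype _))
    fun J x _ hx h ↦ cyclesTensorInjective_quotient_sup_span hd hHflat hCflat J x hx h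
  have hker : p = LinearMap.ker (Algebra.linearMap R
      (Localization.AtPrime p ⧸ IsLocalRing.maximalIdeal (Localization.AtPrime p))) := by
    ext r
    rw [LinearMap.mem_ker, Algebra.linearMap_apply,
      IsScalarTower.algebraMap_apply R (Localization.AtPrime p), Ideal.Quotient.algebraMap_eq,
      Ideal.Quotient.eq_zero_iff_mem, IsLocalization.AtPrime.to_map_mem_maximal_iff _ p]
  have hg : Function.Injective (p.liftQ _ hker.le) :=
    LinearMap.ker_eq_bot.1 (Submodule.ker_liftQ_eq_bot' _ _ hker)
  exact LinearMap.rTensor_injective_of_lTensor_injective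
    (Module.Flat.lTensor_preserves_injective_linearMap (f.restrictScalars R ∘ₗ p.liftQ _ hker.le)
      (hf.comp hg)) (hJ n)

theorem cyclesTensorInjective_of_flat_cycles [IsNoetherianRing R]
    (hd : ∀ n : ℤ, (d (n - 1)).comp (d n) = 0)
    (hHflat : ∀ n : ℤ, Module.Flat R (homologyAt d n))
    (hCflat : ∀ n : ℤ, Module.Flat R (C n)) (hZ : Module.Flat R (cyclesAt d n)) :
    CyclesTensorInjective d n M := by
  have := hCflat n
  suffices h : ∀ (N : Type) [AddCommGroup N] [Module R N], Module.Finite R N →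
      Function.Injective ((cyclesAt d n).subtype.rTensor N) from
    LinearMap.rTensor_injective_of_finite fun N ↦ h N
  intro N _ _ hN
  induction hN using IsNoetherianRing.induction_on_isQuotientEquivQuotientPrime R with
  | subsingleton N => exact Function.injective_of_subsingleton _
  | quotient N p e =>
    exact LinearMap.rTensor_injective_of_lTensor_injective
      (Module.Flat.lTensor_preserves_injective_linearMap e.toLinearMap e.injective)
      (cyclesTensorInjective_quotient_prime hd hHflat hCflat hZ p.1)
  | exact N₁ N₂ N₃ f g hf hg hfg h₁ h₃ =>
    exact LinearMap.rTensor_injective_of_exact hf hg hfg h₁ h₃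

theorem flat_cyclesAt_sub_one
    (hd : ∀ n : ℤ, (d (n - 1)).comp (d n) = 0)
    (hHflat : ∀ n : ℤ, Module.Flat R (homologyAt d n))
    (hCflat : ∀ n : ℤ, Module.Flat R (C n))
    (h : ∀ (M : Type) [AddCommGroup M] [Module R M], CyclesTensorInjective d n M) :
    Module.Flat R (cyclesAt d (n - 1)) := by
  have := hCflat n
  have := hHflat (n - 1)
  have : Module.Flat R (boundariesAt d (n - 1)) := by
    rw [boundariesAt_sub_one]
    refine Module.Flat.of_rTensor_injective (i := (cyclesAt d n).subtype)
      (d n).surjective_rangeRestrict ?_ h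
    rw [LinearMap.exact_iff, LinearMap.ker_rangeRestrict, Submodule.range_subtype, cyclesAt]
  exact Module.Flat.of_exact (Submodule.inclusion_injective _) (Submodule.mkQ_surjective _)
    (exact_inclusion_mkQ hd (n - 1))

theorem flat_cyclesAt [IsNoetherianRing R]
    (hd : ∀ n : ℤ, (d (n - 1)).comp (d n) = 0)
    (hHflat : ∀ n : ℤ, Module.Flat R (homologyAt d n))
    (hCflat : ∀ n : ℤ, Module.Flat R (C n))
    (hnonpos : ∀ n : ℤ, 0 < n → Subsingleton (C n)) (n : ℤ) : Module.Flat R (cyclesAt d n) := by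
  rcases lt_or_ge 0 n with hn | hn
  · have := hnonpos n hn
    infer_instance
  · refine Int.leInductionDown (m := 1) (motive := fun n _ ↦ Module.Flat R (cyclesAt d n))
      ?_ (fun n _ ih ↦ ?_) n (by lia)
    · have := hnonpos 1 one_pos
      infer_instance
    · exact flat_cyclesAt_sub_one hd hHflat hCflat fun M _ _ ↦
        cyclesTensorInjective_of_flat_cycles hd hHflat hCflat ih

theorem IsHomologyTensorComparison.bijective
    (hd : ∀ n : ℤ, (d (n - 1)).comp (d n) = 0)
    (hHflat : ∀ n : ℤ, Module.Flat R (homologyAt d n))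
    (h : ∀ n : ℤ, CyclesTensorInjective d n M)
    {φ : (homologyAt d n) ⊗[R] M →ₗ[R]
      homologyAt (C := fun k => C k ⊗[R] M) (fun k => (d k).rTensor M) n}
    (hφ : IsHomologyTensorComparison d M n φ) : Function.Bijective φ := by
  let π := ((boundariesAt d n).comap (cyclesAt d n).subtype).mkQ
  have hmem (z : cyclesAt d n ⊗[R] M) : (cyclesAt d n).subtype.rTensor M z ∈
      cyclesAt (C := fun k => C k ⊗[R] M) (fun k => (d k).rTensor M) n :=
    (exact_rTensor_cyclesAt hd hHflat (h (n - 1))).apply_apply_eq_zero z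
  have hφπ (z : cyclesAt d n ⊗[R] M) : φ (π.rTensor M z) = Submodule.Quotient.mk ⟨_, hmem z⟩ := by
    induction z with
    | zero =>
      rw [map_zero, map_zero, eq_comm, Submodule.Quotient.mk_eq_zero]
      simp
    | tmul z m => exact hφ z m _
    | add z w hz hw =>
      rw [map_add, map_add, hz, hw, ← Submodule.Quotient.mk_add]
      congr 1
      exact Subtype.ext (map_add _ z w).symm
  constructor
  · rw [injective_iff_map_eq_zero]
    intro x hx
    obtain ⟨z, rfl⟩ := LinearMap.rTensor_surjective M (Submodule.mkQ_surjective _) x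
    rw [hφπ, Submodule.Quotient.mk_eq_zero] at hx
    obtain ⟨b, hb⟩ := exists_rTensor_boundariesAt d n M hx
    rw [← Submodule.subtype_comp_inclusion _ _ (boundariesAt_le_cyclesAt hd n),
      LinearMap.rTensor_comp_apply] at hb
    rw [← h n hb]
    exact (rTensor_exact M (exact_inclusion_mkQ hd n)
      (Submodule.mkQ_surjective _)).apply_apply_eq_zero b
  · intro y
    obtain ⟨⟨y, hy⟩, rfl⟩ := Submodule.Quotient.mk_surjective _ y
    obtain ⟨z, rfl⟩ := (exact_rTensor_cyclesAt hd hHflat (h (n - 1)) y).1 hy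
    exact ⟨π.rTensor M z, hφπ z⟩

end FlatComplex

/-- Let `R` be a commutative Noetherian ring of finite Krull dimension and
`(C, d)` a chain complex of `R`-modules concentrated in non-positive degrees with all
`C n` flat and all homology modules flat.  Then for every `R`-module `M` and every `n`
the natural map `H_n(C) ⊗ M → H_n(C ⊗ M)` is an isomorphism; in particular this holds
for `M = R/pR` for every prime number `p`. -/
theorem steenrod_stmt_7 (R : Type) [CommRing R] [IsNoetherianRing R]
    (hdim : ∃ dd : ℕ, ringKrullDim R ≤ (dd : WithBot (WithTop ℕ)))
    (C : ℤ → Type) [∀ n, AddCommGroup (C n)] [∀ n, Module R (C n)]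
    (d : ∀ n : ℤ, C n →ₗ[R] C (n - 1))
    (hcomplex : ∀ n : ℤ, (d (n - 1)).comp (d n) = 0)
    (hnonpos : ∀ n : ℤ, 0 < n → Subsingleton (C n))
    (hCflat : ∀ n : ℤ, Module.Flat R (C n))
    (hHflat : ∀ n : ℤ, Module.Flat R (homologyAt d n)) :
    (∀ (M : Type) [AddCommGroup M] [Module R M] (n : ℤ)
      (φ : (homologyAt d n) ⊗[R] M →ₗ[R]
        homologyAt (C := fun k => C k ⊗[R] M) (fun k => (d k).rTensor M) n),
      IsHomologyTensorComparison d M n φ → Function.Bijective φ) ∧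
    (∀ (p : ℕ), p.Prime → ∀ (n : ℤ)
      (φ : (homologyAt d n) ⊗[R] (R ⧸ Ideal.span {(p : R)}) →ₗ[R]
        homologyAt (C := fun k => C k ⊗[R] (R ⧸ Ideal.span {(p : R)}))
          (fun k => (d k).rTensor (R ⧸ Ideal.span {(p : R)})) n),
      IsHomologyTensorComparison d (R ⧸ Ideal.span {(p : R)}) n φ →
        Function.Bijective φ) := by
  have main (M : Type) [AddCommGroup M] [Module R M] (n : ℤ) : CyclesTensorInjective d n M :=
    cyclesTensorInjective_of_flat_cycles hcomplex hHflat hCflat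
      (flat_cyclesAt hcomplex hHflat hCflat hnonpos n)
  exact ⟨fun M _ _ n φ hφ ↦ hφ.bijective hcomplex hHflat (main M),
    fun p _ n φ hφ ↦ hφ.bijective hcomplex hHflat (main _)⟩
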